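/- Let p be a prime number and c = (c_k)_{k≥0} a bounded sequence of integers. For every ε > 0 there exists an integer M such that for all integers m, u, n with M ≤ m ≤ u ≤ n and all real numbers θ_m, θ_n such that x_m has a partial quotient equal to p^{θ_m m} and x_n has a partial quotient equal to p^{θ_n n}, one has η_u ≥ (m(1 + θ_m) − n(1 − θ_n))/(m(1 + θ_m) + n(1 − θ_n)) − ε. -/

import Mathlib

open Filter

/-- The rational number `x_m = c₀/p^m + c₁/p^{m-1} + ⋯ + c_{m-1}/p`. -/
noncomputable def xm (p : ℕ) (c : ℕ → ℤ) (m : ℕ) : ℚ :=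
  ∑ k ∈ Finset.range m, (c k : ℚ) / (p : ℚ) ^ (m - k)

/-- The largest partial quotient of the continued fraction expansion of `x`. -/
noncomputable def maxPartQuot (x : ℚ) : ℝ :=
  sSup {r : ℝ | ∃ q ∈ (GenContFract.of x).partDens, r = (q : ℝ)}

/-- `η_m`, the real number such that the largest partial quotient of `x_m` is `p^{η_m m}`. -/
noncomputable def etaSeq (p : ℕ) (c : ℕ → ℤ) (m : ℕ) : ℝ :=
  Real.logb p (maxPartQuot (xm p c m)) / m

namespace GenContFract

open GenContFract (of)

variable {K : Type*} [Field K] [LinearOrder K] [FloorRing K]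

theorem exists_int_contsAux (v : K) (n : ℕ) :
    ∃ a b : ℤ, (of v).contsAux n = ⟨(a : K), (b : K)⟩ := by
  induction n using Nat.twoStepInduction with
  | zero => exact ⟨1, 0, by simp⟩
  | one => exact ⟨⌊v⌋, 1, by simp⟩
  | more n ih₁ ih₂ =>
    obtain ⟨a, b, h₁⟩ := ih₁
    obtain ⟨a', b', h₂⟩ := ih₂
    rcases hs : (of v).s.get? n with _ | gp
    · exact ⟨a', b', by rw [contsAux_stable_step_of_terminated hs, h₂]⟩
    · obtain ⟨ha, z, hz⟩ := of_partNum_eq_one_and_exists_int_partDen_eq hs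
      refine ⟨z * a' + a, z * b' + b, ?_⟩
      rw [contsAux_recurrence hs h₁ h₂, ha, hz]
      push_cast
      simp

variable [IsStrictOrderedRing K]

/-- The convergent preceding the partial denominator `d`, as a reduced fraction, together with the
two-sided estimate of the quality of approximation. -/
theorem exists_coprime_convs_eq {v d : K} {n : ℕ} (hd : (of v).partDens.get? n = some d) :
    ∃ a b : ℤ, 0 < b ∧ IsCoprime a b ∧ (of v).convs n = a / b ∧ v ≠ a / b ∧
      d * b ^ 2 * |v - a / b| ≤ 1 ∧ 1 ≤ (d + 2) * b ^ 2 * |v - a / b| := by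
  have hterm : ¬(of v).TerminatedAt n := by
    simp [terminatedAt_iff_partDen_none, hd]
  obtain ⟨gp, hs, rfl⟩ := exists_s_b_of_partDen hd
  obtain ⟨ifp', hstream', hb'⟩ :=
    IntFractPair.exists_succ_get?_stream_of_gcf_of_get?_eq_some hs
  obtain ⟨ifp, hstream, hfr, hof⟩ := IntFractPair.succ_nth_stream_eq_some_iff.mp hstream'
  have hfr0 : 0 < ifp.fr :=
    lt_of_le_of_ne (IntFractPair.nth_stream_fr_nonneg hstream) hfr.symm
  have hfloor : gp.b = (⌊ifp.fr⁻¹⌋ : K) := by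
    rw [← hb', ← hof]
    rfl
  have hle : gp.b ≤ ifp.fr⁻¹ := hfloor ▸ Int.floor_le _
  have hlt : ifp.fr⁻¹ < gp.b + 1 := hfloor ▸ Int.lt_floor_add_one _
  obtain ⟨a, b, hab⟩ := exists_int_contsAux v (n + 1)
  obtain ⟨a', b', hab'⟩ := exists_int_contsAux v (n + 2)
  have hconv : (of v).convs n = a / b := by
    rw [conv_eq_conts_a_div_conts_b, nth_cont_eq_succ_nth_contAux, hab]
  have hone : (1 : K) ≤ b := by
    have h := succ_nth_fib_le_of_nth_den (v := v) (n := n)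
      (n.eq_zero_or_pos.imp_right fun _ h => hterm (terminated_stable (Nat.sub_le n 1) h))
    rw [den_eq_conts_b, nth_cont_eq_succ_nth_contAux, hab] at h
    refine le_trans ?_ h
    exact_mod_cast Nat.fib_pos.mpr n.succ_pos
  have hb : (0 : K) < b := zero_lt_one.trans_le hone
  have hcop : IsCoprime a b := by
    have hdet := SimpContFract.determinant (s := SimpContFract.of v) hterm
    change (of v).nums n * (of v).dens (n + 1) - (of v).dens n * (of v).nums (n + 1) = _ at hdet
    simp only [num_eq_conts_a, den_eq_conts_b, nth_cont_eq_succ_nth_contAux, hab, hab'] at hdet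
    have hdet' : a * b' - b * a' = (-1) ^ (n + 1) := by exact_mod_cast hdet
    have hsq : ((-1 : ℤ) ^ (n + 1)) * (-1) ^ (n + 1) = 1 := by
      rw [← mul_pow]; simp
    exact ⟨(-1) ^ (n + 1) * b', -((-1) ^ (n + 1) * a'), by
      linear_combination (-1) ^ (n + 1) * hdet' + hsq⟩
  have hsub := sub_convs_eq hstream
  have hpB0 : 0 ≤ ((of v).contsAux n).b := zero_le_of_contsAux_b
  have hpB : ((of v).contsAux n).b ≤ b := by
    cases n with
    | zero => simpa using hb.le
    | succ k =>
      have h := of_den_mono (v := v) (n := k)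
      rwa [den_eq_conts_b, den_eq_conts_b, nth_cont_eq_succ_nth_contAux,
        nth_cont_eq_succ_nth_contAux, hab] at h
  simp only [hfr, if_false, hab, hconv] at hsub
  set e := ((of v).contsAux n).b
  have hinv : 0 < ifp.fr⁻¹ := inv_pos.mpr hfr0
  have hD : 0 < ifp.fr⁻¹ * b + e := by positivity
  have habs : |v - a / b| = 1 / (b * (ifp.fr⁻¹ * b + e)) := by
    rw [hsub, abs_div, abs_pow, abs_neg, abs_one, one_pow, abs_of_pos (mul_pos hb hD)]
  refine ⟨a, b, by exact_mod_cast hb, hcop, hconv, ?_, ?_, ?_⟩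
  · rw [← sub_ne_zero, ← abs_pos, habs]
    positivity
  · rw [habs, mul_one_div, div_le_one (by positivity)]
    nlinarith [mul_le_mul_of_nonneg_right hle (sq_nonneg (b : K)), mul_nonneg hb.le hpB0]
  · rw [habs, mul_one_div, one_le_div (by positivity)]
    nlinarith [mul_le_mul_of_nonneg_right hlt.le (sq_nonneg (b : K)),
      mul_le_mul_of_nonneg_left hpB hb.le]

theorem convs_eq_convergent_ratCast (x : ℚ) (n : ℕ) :
    (of x).convs n = (x : ℝ).convergent n := by
  induction n generalizing x with
  | zero => simp
  | succ n ih =>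
    rw [convs_succ, ih, Real.convergent_succ, one_div]
    simp

/-- Every fraction `h / q ≠ x` approximates `x` no better than the partial denominators of `x`
allow. -/
theorem exists_partDens_one_le_of_ne {x : ℚ} {h q : ℤ} (hq : q ≠ 0) (hne : q * x ≠ h) :
    1 ≤ 2 * (|(q : ℚ)| * |q * x - h|) ∨
      ∃ d ∈ (of x).partDens, 1 ≤ (d + 2) * (|(q : ℚ)| * |q * x - h|) := by
  rw [or_iff_not_imp_left, not_le]
  intro hlt
  have hq' : (q : ℚ) ≠ 0 := by exact_mod_cast hq
  have hqpos : 0 < |(q : ℚ)| := abs_pos.mpr hq'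
  have hprod : |(q : ℚ)| * |q * x - h| = (q : ℚ) ^ 2 * |x - h / q| := by
    rw [← sq_abs (q : ℚ), sq, mul_assoc, ← abs_mul (q : ℚ) (x - h / q)]
    congr 2
    field_simp
  rw [hprod] at hlt ⊢
  have hden : (((h / q : ℚ).den : ℕ) : ℤ) ∣ q := by
    rw [← Rat.divInt_eq_div]
    exact Rat.den_dvd h q
  have hdenle : (((h / q : ℚ).den : ℕ) : ℚ) ^ 2 ≤ (q : ℚ) ^ 2 := by
    have := Int.le_of_dvd (by positivity) (pow_dvd_pow_of_dvd hden 2)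
    exact_mod_cast this
  have hdenpos : (0 : ℚ) < ((h / q : ℚ).den : ℕ) := by exact_mod_cast Rat.den_pos _
  obtain ⟨n, hn⟩ : ∃ n, (h / q : ℚ) = (x : ℝ).convergent n := by
    apply Real.exists_rat_eq_convergent
    have : |x - h / q| < 1 / (2 * (((h / q : ℚ).den : ℕ) : ℚ) ^ 2) := by
      rw [lt_div_iff₀ (by positivity)]
      nlinarith [mul_le_mul_of_nonneg_right hdenle (abs_nonneg (x - h / q))]
    generalize (h / q : ℚ) = ρ at this ⊢
    have hcast := Rat.cast_lt (K := ℝ).mpr this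
    push_cast at hcast
    exact hcast
  rw [← convs_eq_convergent_ratCast] at hn
  have hterm : (of x).partDens.get? n ≠ none := by
    intro hnone
    apply hne
    have := of_correctness_of_terminatedAt (terminatedAt_iff_partDen_none.mpr hnone)
    rw [← hn] at this
    rw [this]
    field_simp
  obtain ⟨d, hd⟩ := Option.ne_none_iff_exists'.mp hterm
  obtain ⟨a, b, hb, hcop, hconv, -, -, hlower⟩ := exists_coprime_convs_eq hd
  refine ⟨d, ⟨n, hd.symm⟩, ?_⟩
  have hd1 : 1 ≤ d := of_one_le_get?_partDen hd
  rw [← hconv, ← hn] at hlower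
  have hb' : (b : ℚ) ≠ 0 := by exact_mod_cast hb.ne'
  have hdvd : b ∣ q := by
    have hcross : a * q = h * b := by
      have := hn.trans hconv
      rw [div_eq_div_iff hq' hb'] at this
      exact_mod_cast this.symm
    exact hcop.symm.dvd_of_dvd_mul_left ⟨h, by rw [hcross, mul_comm]⟩
  have hble : (b : ℚ) ^ 2 ≤ (q : ℚ) ^ 2 := by
    exact_mod_cast Int.le_of_dvd (by positivity) (pow_dvd_pow_of_dvd hdvd 2)
  calc (1 : ℚ) ≤ (d + 2) * (b : ℚ) ^ 2 * |x - h / q| := hlower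
    _ ≤ (d + 2) * (q : ℚ) ^ 2 * |x - h / q| := by gcongr
    _ = _ := by ring

theorem exists_approx_of_mem_partDens {x d : ℚ} (hd : d ∈ (of x).partDens) :
    1 ≤ d ∧ ∃ h q : ℤ, 0 < q ∧ q * x ≠ h ∧ d * (|(q : ℚ)| * |q * x - h|) ≤ 1 := by
  obtain ⟨n, hn⟩ := hd
  obtain ⟨a, b, hb, -, -, hne, hle, -⟩ := exists_coprime_convs_eq hn.symm
  have hb' : (0 : ℚ) < b := by exact_mod_cast hb
  refine ⟨of_one_le_get?_partDen hn.symm, a, b, hb, ?_, ?_⟩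
  · rwa [Ne, eq_div_iff hb'.ne', mul_comm] at hne
  · have hmul : b * x - a = b * (x - a / b) := by field_simp
    rw [hmul, abs_mul, abs_of_pos hb', ← mul_assoc (b : ℚ), ← sq, ← mul_assoc]
    exact hle

theorem finite_setOf_mem_partDens (x : ℚ) : {d : ℚ | d ∈ (of x).partDens}.Finite := by
  obtain ⟨N, hN⟩ := terminates_of_rat x
  refine ((Set.finite_lt_nat N).image fun n => ((of x).partDens.get? n).getD 0).subset ?_
  rintro d ⟨n, hn⟩
  have hn' : (of x).partDens.get? n = some d := hn.symm
  refine ⟨n, ?_, by simp [hn']⟩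
  by_contra! hle
  have hterm := terminatedAt_iff_partDen_none.mp (terminated_stable (not_lt.mp hle) hN)
  simp [hn'] at hterm

end GenContFract

theorem le_maxPartQuot {x d : ℚ} (hd : d ∈ (GenContFract.of x).partDens) :
    (d : ℝ) ≤ maxPartQuot x := by
  refine le_csSup ?_ ⟨d, hd, rfl⟩
  refine (((GenContFract.finite_setOf_mem_partDens x).image ((↑) : ℚ → ℝ)).subset ?_).bddAbove
  rintro r ⟨q, hq, rfl⟩
  exact ⟨q, hq, rfl⟩

theorem one_le_three_mul_max_maxPartQuot {x : ℚ} {h q : ℤ} (hq : q ≠ 0) (hne : q * x ≠ h) :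
    1 ≤ 3 * max (maxPartQuot x) 1 * (|(q : ℝ)| * |(q : ℝ) * x - h|) := by
  have hnn : 0 ≤ |(q : ℝ)| * |(q : ℝ) * x - h| := by positivity
  have hmax : 1 ≤ max (maxPartQuot x) 1 := le_max_right _ _
  rcases GenContFract.exists_partDens_one_le_of_ne hq hne with h2 | ⟨d, hd, h2⟩
  · have h2' : (1 : ℝ) ≤ 2 * (|(q : ℝ)| * |(q : ℝ) * x - h|) := by exact_mod_cast h2
    nlinarith
  · have h2' : (1 : ℝ) ≤ (d + 2) * (|(q : ℝ)| * |(q : ℝ) * x - h|) := by exact_mod_cast h2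
    have hdle := (le_maxPartQuot hd).trans (le_max_left _ 1)
    nlinarith

theorem logb_maxPartQuot (b : ℝ) (x : ℚ) :
    Real.logb b (maxPartQuot x) = Real.logb b (max (maxPartQuot x) 1) := by
  rcases Set.eq_empty_or_nonempty {r : ℝ | ∃ q ∈ (GenContFract.of x).partDens, r = (q : ℝ)}
    with hempty | ⟨_, d, hd, -⟩
  · simp [maxPartQuot, hempty]
  · have hd1 : (1 : ℝ) ≤ d := by exact_mod_cast (GenContFract.exists_approx_of_mem_partDens hd).1
    rw [max_eq_left (hd1.trans (le_maxPartQuot hd))]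

theorem exists_int_pow_mul_xm {p : ℕ} (hp : p ≠ 0) (c : ℕ → ℤ) (m k : ℕ) :
    ∃ w : ℤ, (p : ℚ) ^ k * xm p c (m + k) = xm p c m + w := by
  have hp' : (p : ℚ) ≠ 0 := by exact_mod_cast hp
  refine ⟨∑ j ∈ Finset.range k, c (m + j) * (p : ℤ) ^ j, ?_⟩
  rw [xm, xm, Finset.sum_range_add, mul_add, Finset.mul_sum, Finset.mul_sum]
  push_cast
  congr 1
  · refine Finset.sum_congr rfl fun j hj => ?_
    rw [show m + k - j = k + (m - j) by have := Finset.mem_range.mp hj; omega, pow_add]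
    field_simp
  · refine Finset.sum_congr rfl fun j hj => ?_
    have hjk := Finset.mem_range.mp hj
    rw [show m + k - (m + j) = k - j by omega]
    have : (p : ℚ) ^ k = p ^ j * p ^ (k - j) := by rw [← pow_add]; congr 1; omega
    rw [this]
    field_simp

theorem exists_int_pow_mul_xm_eq {p : ℕ} (hp : p ≠ 0) (c : ℕ → ℤ) (m : ℕ) :
    ∃ w : ℤ, (p : ℚ) ^ m * xm p c m = w := by
  obtain ⟨w, hw⟩ := exists_int_pow_mul_xm hp c 0 m
  exact ⟨w, by simpa [xm] using hw⟩

theorem partDens_xm_le_pow {p : ℕ} (hp : p ≠ 0) (c : ℕ → ℤ) {n : ℕ} {d : ℚ}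
    (hd : d ∈ (GenContFract.of (xm p c n)).partDens) : d ≤ (p : ℚ) ^ n := by
  obtain ⟨hd1, h, q, hq, hne, hle⟩ := GenContFract.exists_approx_of_mem_partDens hd
  obtain ⟨w, hw⟩ := exists_int_pow_mul_xm_eq hp c n
  have hpn : (0 : ℚ) < (p : ℚ) ^ n := by positivity
  have hqabs : (1 : ℚ) ≤ |(q : ℚ)| := by exact_mod_cast Int.one_le_abs hq.ne'
  have hint : (1 : ℚ) ≤ (p : ℚ) ^ n * |q * xm p c n - h| := by
    nth_rw 1 [← abs_of_pos hpn]
    rw [← abs_mul]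
    have heq : (p : ℚ) ^ n * (q * xm p c n - h) = ((q * w - p ^ n * h : ℤ) : ℚ) := by
      push_cast
      linear_combination (q : ℚ) * hw
    have hne0 : (p : ℚ) ^ n * (q * xm p c n - h) ≠ 0 := mul_ne_zero hpn.ne' (sub_ne_zero.mpr hne)
    rw [heq] at hne0 ⊢
    exact_mod_cast Int.one_le_abs (by exact_mod_cast hne0)
  calc d ≤ d * ((p : ℚ) ^ n * |q * xm p c n - h|) := le_mul_of_one_le_right (by linarith) hint
    _ ≤ d * ((p : ℚ) ^ n * (|(q : ℚ)| * |q * xm p c n - h|)) := by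
      gcongr
      exact le_mul_of_one_le_left (abs_nonneg _) hqabs
    _ = (p : ℚ) ^ n * (d * (|(q : ℚ)| * |q * xm p c n - h|)) := by ring
    _ ≤ (p : ℚ) ^ n := mul_le_of_le_one_right hpn.le hle

/-- A partial quotient `d` of `x_m` bounds the largest partial quotient of `x_{m+k}` from below. -/
theorem le_pow_mul_maxPartQuot_xm_add {p : ℕ} (hp : p ≠ 0) (c : ℕ → ℤ) (m k : ℕ) {d : ℚ}
    (hd : d ∈ (GenContFract.of (xm p c m)).partDens) :
    (d : ℝ) ≤ 3 * max (maxPartQuot (xm p c (m + k))) 1 * (p : ℝ) ^ k := by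
  obtain ⟨hd1, h, q, hq, hne, hle⟩ := GenContFract.exists_approx_of_mem_partDens hd
  obtain ⟨w, hw⟩ := exists_int_pow_mul_xm hp c m k
  have hp' : (p : ℤ) ^ k ≠ 0 := by positivity
  have heq : ((p ^ k * q : ℤ) : ℚ) * xm p c (m + k) - ((h + q * w : ℤ) : ℚ)
      = q * xm p c m - h := by
    push_cast
    linear_combination (q : ℚ) * hw
  have key := one_le_three_mul_max_maxPartQuot (x := xm p c (m + k)) (h := h + q * w)
    (mul_ne_zero hp' hq.ne') (by rw [← sub_ne_zero, heq]; exact sub_ne_zero.mpr hne)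
  have heq' : ((p ^ k * q : ℤ) : ℝ) * xm p c (m + k) - ((h + q * w : ℤ) : ℝ)
      = q * xm p c m - h := by exact_mod_cast heq
  rw [heq', Int.cast_mul, abs_mul] at key
  have hpk : |(((p : ℤ) ^ k : ℤ) : ℝ)| = (p : ℝ) ^ k := by
    push_cast
    exact abs_of_nonneg (by positivity)
  rw [hpk] at key
  have hle' : (d : ℝ) * (|(q : ℝ)| * |(q : ℝ) * xm p c m - h|) ≤ 1 := by exact_mod_cast hle
  have hd0 : (0 : ℝ) ≤ d := by exact_mod_cast zero_le_one.trans hd1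
  have hmax : (0 : ℝ) ≤ max (maxPartQuot (xm p c (m + k))) 1 := zero_le_one.trans (le_max_right _ _)
  generalize max (maxPartQuot (xm p c (m + k))) 1 = K at *
  calc (d : ℝ) ≤ d * (3 * K * (p ^ k * |(q : ℝ)| * |(q : ℝ) * xm p c m - h|)) :=
        le_mul_of_one_le_right hd0 key
    _ = 3 * K * p ^ k * (d * (|(q : ℝ)| * |(q : ℝ) * xm p c m - h|)) := by ring
    _ ≤ 3 * K * p ^ k := mul_le_of_le_one_right (by positivity) hle'

/-- A partial quotient `d` of `x_{u+k}` bounds the largest partial quotient of `x_u` from below. -/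
theorem le_pow_mul_maxPartQuot_xm {p : ℕ} (hp : p ≠ 0) (c : ℕ → ℤ) (u k : ℕ) {d : ℚ}
    (hd : d ∈ (GenContFract.of (xm p c (u + k))).partDens) :
    (d : ℝ) ≤ 3 * max (maxPartQuot (xm p c u)) 1 * (p : ℝ) ^ k := by
  obtain ⟨hd1, h, q, hq, hne, hle⟩ := GenContFract.exists_approx_of_mem_partDens hd
  obtain ⟨w, hw⟩ := exists_int_pow_mul_xm hp c u k
  have hp' : (p : ℚ) ^ k ≠ 0 := by positivity
  have heq : (q : ℚ) * xm p c u - ((p ^ k * h - q * w : ℤ) : ℚ)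
      = (p : ℚ) ^ k * (q * xm p c (u + k) - h) := by
    push_cast
    linear_combination -(q : ℚ) * hw
  have key := one_le_three_mul_max_maxPartQuot (x := xm p c u) (h := p ^ k * h - q * w)
    hq.ne' (by rw [← sub_ne_zero, heq]; exact mul_ne_zero hp' (sub_ne_zero.mpr hne))
  have heq' : (q : ℝ) * xm p c u - ((p ^ k * h - q * w : ℤ) : ℝ)
      = (p : ℝ) ^ k * (q * xm p c (u + k) - h) := by exact_mod_cast heq
  rw [heq', abs_mul, abs_of_nonneg (by positivity : (0 : ℝ) ≤ (p : ℝ) ^ k)] at key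
  have hle' : (d : ℝ) * (|(q : ℝ)| * |(q : ℝ) * xm p c (u + k) - h|) ≤ 1 := by exact_mod_cast hle
  have hd0 : (0 : ℝ) ≤ d := by exact_mod_cast zero_le_one.trans hd1
  have hmax : (0 : ℝ) ≤ max (maxPartQuot (xm p c u)) 1 := zero_le_one.trans (le_max_right _ _)
  generalize max (maxPartQuot (xm p c u)) 1 = K at *
  calc (d : ℝ) ≤ d * (3 * K * (|(q : ℝ)| * (p ^ k * |(q : ℝ) * xm p c (u + k) - h|))) :=
        le_mul_of_one_le_right hd0 key
    _ = 3 * K * p ^ k * (d * (|(q : ℝ)| * |(q : ℝ) * xm p c (u + k) - h|)) := by ring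
    _ ≤ 3 * K * p ^ k := mul_le_of_le_one_right (by positivity) hle'

theorem le_logb_of_rpow_le {b K t : ℝ} {k : ℕ} (hb : 1 < b) (hK : 1 ≤ K)
    (h : b ^ t ≤ 3 * K * b ^ k) : t ≤ Real.logb b 3 + Real.logb b K + k := by
  have hb0 : 0 < b := zero_lt_one.trans hb
  have hlog := Real.logb_le_logb_of_le hb (Real.rpow_pos_of_pos hb0 t) h
  rwa [Real.logb_rpow hb0 hb.ne', Real.logb_mul (by positivity) (by positivity),
    Real.logb_mul (by norm_num) (by positivity), Real.logb_pow, Real.logb_self_eq_one hb,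
    mul_one] at hlog

theorem eta_lower_bound (p : ℕ) (hp : p.Prime) (c : ℕ → ℤ)
    (hc : ∃ B : ℝ, ∀ k, |(c k : ℝ)| ≤ B) :
    ∀ ε : ℝ, 0 < ε → ∃ M : ℕ, ∀ m u n : ℕ, M ≤ m → m ≤ u → u ≤ n →
      ∀ θm θn : ℝ,
        (∃ q ∈ (GenContFract.of (xm p c m)).partDens, (q : ℝ) = (p : ℝ) ^ (θm * m)) →
        (∃ q ∈ (GenContFract.of (xm p c n)).partDens, (q : ℝ) = (p : ℝ) ^ (θn * n)) →
        etaSeq p c u ≥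
          ((m : ℝ) * (1 + θm) - (n : ℝ) * (1 - θn)) /
            ((m : ℝ) * (1 + θm) + (n : ℝ) * (1 - θn)) - ε := by
  intro ε hε
  have hp1 : (1 : ℝ) < p := by exact_mod_cast hp.one_lt
  have hp0 : (0 : ℝ) < p := zero_lt_one.trans hp1
  refine ⟨⌈Real.logb p 3 / ε⌉₊ + 1, ?_⟩
  rintro m u n hM hmu hun θm θn ⟨dm, hdm, hθm⟩ ⟨dn, hdn, hθn⟩
  have hm1 : (1 : ℝ) ≤ m := by exact_mod_cast (Nat.le_add_left 1 _).trans hM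
  have hmu' : (m : ℝ) ≤ u := by exact_mod_cast hmu
  have hθm0 : 0 ≤ θm * m := by
    have h : (1 : ℝ) ≤ dm := by exact_mod_cast (GenContFract.exists_approx_of_mem_partDens hdm).1
    rw [hθm, ← Real.rpow_zero (p : ℝ)] at h
    exact (Real.rpow_le_rpow_left_iff hp1).mp h
  have hθn1 : θn * n ≤ n := by
    have h : (dn : ℝ) ≤ (p : ℝ) ^ n := by exact_mod_cast partDens_xm_le_pow hp.ne_zero c hdn
    rw [hθn, ← Real.rpow_natCast] at h
    exact (Real.rpow_le_rpow_left_iff hp1).mp h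
  obtain ⟨k, rfl⟩ := Nat.exists_eq_add_of_le hmu
  obtain ⟨l, rfl⟩ := Nat.exists_eq_add_of_le hun
  have hlower := le_pow_mul_maxPartQuot_xm_add hp.ne_zero c m k hdm
  have hupper := le_pow_mul_maxPartQuot_xm hp.ne_zero c (m + k) l hdn
  rw [hθm] at hlower
  rw [hθn] at hupper
  have h₁ := le_logb_of_rpow_le hp1 (le_max_right _ _) hlower
  have h₂ := le_logb_of_rpow_le hp1 (le_max_right _ _) hupper
  rw [← logb_maxPartQuot] at h₁ h₂
  rw [etaSeq, ge_iff_le]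
  have hlog : Real.logb p 3 ≤ ε * (m + k : ℕ) := by
    have h : Real.logb p 3 / ε ≤ (m + k : ℕ) :=
      (Nat.le_ceil _).trans (by exact_mod_cast (Nat.le_succ _).trans (hM.trans hmu))
    rwa [div_le_iff₀' hε] at h
  generalize Real.logb p (maxPartQuot (xm p c (m + k))) = y at *
  generalize Real.logb p 3 = L at *
  push_cast at *
  have hu : (0 : ℝ) < m + k := by linarith
  have hA : 0 < (m : ℝ) * (1 + θm) := by linarith
  have hB : 0 ≤ ((m : ℝ) + k + l) * (1 - θn) := by linarith
  have h₁' : (m : ℝ) * (1 + θm) - (m + k) ≤ y + L := by linarith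
  have h₂' : (m + k : ℝ) - (m + k + l) * (1 - θn) ≤ y + L := by linarith
  generalize (m : ℝ) * (1 + θm) = A at *
  generalize ((m : ℝ) + k + l) * (1 - θn) = B at *
  have hratio : (A - B) / (A + B) * (m + k) ≤ y + L := by
    rw [div_mul_eq_mul_div, div_le_iff₀ (by linarith)]
    nlinarith [mul_le_mul_of_nonneg_left h₁' hB, mul_le_mul_of_nonneg_left h₂' hA.le]
  rw [le_div_iff₀ hu]
  linarith
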